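/- arXiv:1804.10715 — 3 statements merged into one kernel-verified Lean document; each statement's English description precedes it below -/
import Mathlib

section
/- If there exists a skew Hadamard matrix of order n ≥ 2, then for every permutation matrix P of order n and every α ∈ [−1/(n−1), 1], the bistochastic matrix R_α = α·P + (1−α)·W_n is orthostochastic. -/
open Matrix

/-- A real skew Hadamard matrix: entries of modulus one, orthogonal rows
(`H * Hᵀ = n • 1`), and `H + Hᵀ = 2 • 1`. -/
def IsSkewHadamard {n : ℕ} (H : Matrix (Fin n) (Fin n) ℝ) : Prop :=
  (∀ i j, |H i j| = 1) ∧ H * Hᵀ = (n : ℝ) • 1 ∧ H + Hᵀ = (2 : ℝ) • 1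

/-- A real matrix `B` is orthostochastic if `B_{ij} = O_{ij}²` for some real
orthogonal matrix `O`. -/
def IsOrthostochastic {n : ℕ} (B : Matrix (Fin n) (Fin n) ℝ) : Prop :=
  ∃ O ∈ Matrix.orthogonalGroup (Fin n) ℝ, ∀ i j, B i j = (O i j) ^ 2

/-- The flat (van der Waerden) bistochastic matrix `W_n`, all entries `1/n`. -/
noncomputable def flatMatrix (n : ℕ) : Matrix (Fin n) (Fin n) ℝ := of fun _ _ => (1 : ℝ) / n

/-- If `H` is skew Hadamard, then `(a - b) • 1 + b • H`, which has diagonal entries `a` and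
off-diagonal entries `± b`, is orthogonal as soon as `a ^ 2 + (n - 1) * b ^ 2 = 1`. -/
theorem IsSkewHadamard.smul_one_add_smul_mul_transpose {n : ℕ} {H : Matrix (Fin n) (Fin n) ℝ}
    (hH : IsSkewHadamard H) {a b : ℝ} (hab : a ^ 2 + ((n : ℝ) - 1) * b ^ 2 = 1) :
    ((a - b) • (1 : Matrix (Fin n) (Fin n) ℝ) + b • H) * ((a - b) • 1 + b • H)ᵀ = 1 := by
  obtain ⟨-, hmul, hadd⟩ := hH
  calc ((a - b) • (1 : Matrix (Fin n) (Fin n) ℝ) + b • H) * ((a - b) • 1 + b • H)ᵀ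
      = ((a - b) ^ 2) • 1 + ((a - b) * b) • (H + Hᵀ) + (b ^ 2) • (H * Hᵀ) := by
        simp only [transpose_add, transpose_smul, transpose_one, add_mul, mul_add, smul_mul_assoc,
          mul_smul_comm, one_mul, mul_one]
        module
    _ = (a ^ 2 + ((n : ℝ) - 1) * b ^ 2) • 1 := by
        rw [hmul, hadd]
        module
    _ = 1 := by rw [hab, one_smul]

/-- The diagonal entries of a skew Hadamard matrix are `1`. -/
theorem IsSkewHadamard.diag_eq_one {n : ℕ} {H : Matrix (Fin n) (Fin n) ℝ}
    (hH : IsSkewHadamard H) (i : Fin n) : H i i = 1 := by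
  have h : (H + Hᵀ) i i = ((2 : ℝ) • (1 : Matrix (Fin n) (Fin n) ℝ)) i i := by rw [hH.2.2]
  simp only [Matrix.add_apply, transpose_apply, Matrix.smul_apply, one_apply_eq, smul_eq_mul] at h
  linarith

/-- If a skew Hadamard matrix of order `n ≥ 2` exists, then every matrix
`R_α = α·P + (1-α)·W_n` with `P` a permutation matrix and `α ∈ [-1/(n-1), 1]`
is orthostochastic. -/
theorem skew_implies_rays_orthostochastic {n : ℕ} (hn : 2 ≤ n)
    (hH : ∃ H : Matrix (Fin n) (Fin n) ℝ, IsSkewHadamard H)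
    (σ : Equiv.Perm (Fin n)) (α : ℝ)
    (hα0 : -1 / ((n : ℝ) - 1) ≤ α) (hα1 : α ≤ 1) :
    IsOrthostochastic (α • σ.permMatrix ℝ + (1 - α) • flatMatrix n) := by
  obtain ⟨H, hH⟩ := hH
  have hn2 : (2 : ℝ) ≤ n := by exact_mod_cast hn
  have hn0 : (0 : ℝ) < n := by linarith
  have ha : 0 ≤ α + (1 - α) / n := by
    rw [div_le_iff₀ (by linarith)] at hα0
    have : α + (1 - α) / n = (α * (n - 1) + 1) / n := by field_simp; ring
    rw [this]
    exact div_nonneg (by linarith) hn0.le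
  have hb : 0 ≤ (1 - α) / n := div_nonneg (by linarith) hn0.le
  set a := √(α + (1 - α) / n)
  set b := √((1 - α) / n)
  have ha2 : a ^ 2 = α + (1 - α) / n := Real.sq_sqrt ha
  have hb2 : b ^ 2 = (1 - α) / n := Real.sq_sqrt hb
  have hM := hH.smul_one_add_smul_mul_transpose (a := a) (b := b) (by
    rw [ha2, hb2]; field_simp; ring)
  refine ⟨((a - b) • 1 + b • H).submatrix σ id, ?_, fun i j => ?_⟩
  · rw [mem_orthogonalGroup_iff, transpose_submatrix,
      ← submatrix_mul _ _ σ id σ Function.bijective_id, hM, submatrix_one_equiv]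
  · have hsq : H (σ i) j ^ 2 = 1 := by rw [← sq_abs, hH.1, one_pow]
    by_cases hij : σ i = j
    · subst hij
      simp [flatMatrix, PEquiv.toMatrix_apply, Equiv.Perm.permMatrix, hH.diag_eq_one, ha2,
        div_eq_mul_inv]
    · simp [flatMatrix, PEquiv.toMatrix_apply, Equiv.Perm.permMatrix, one_apply_ne hij, hij,
        mul_pow, hsq, hb2, div_eq_mul_inv]
end

section
/- A permutation matrix Q of order n is strongly complementary to the identity matrix I of order n if and only if Q² = I and every diagonal entry of Q equals 0. -/
open Matrix

/-- Two (permutation) matrices are complementary if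
`P_{ij} = P_{hk} = Q_{ik} = 1` implies `Q_{hj} = 1`. -/
def Complementary {n : ℕ} (P Q : Matrix (Fin n) (Fin n) ℝ) : Prop :=
  ∀ i j h k : Fin n, P i j = 1 → P h k = 1 → Q i k = 1 → Q h j = 1

/-- Two (permutation) matrices are strongly complementary if they are
complementary and their nonzero entries are in different places. -/
def StronglyComplementary {n : ℕ} (P Q : Matrix (Fin n) (Fin n) ℝ) : Prop :=
  Complementary P Q ∧ ∀ i j : Fin n, P i j = 1 → Q i j = 0

theorem permMatrix_apply_eq_one_iff {n : ℕ} (τ : Equiv.Perm (Fin n)) (i j : Fin n) :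
    τ.permMatrix ℝ i j = 1 ↔ τ i = j := by
  simp

theorem permMatrix_mul_self_eq_one_iff {n : ℕ} (τ : Equiv.Perm (Fin n)) :
    τ.permMatrix ℝ * τ.permMatrix ℝ = 1 ↔ ∀ i, τ (τ i) = i := by
  rw [← Matrix.permMatrix_mul]
  constructor
  · intro h i
    rw [← Equiv.Perm.mul_apply, ← permMatrix_apply_eq_one_iff, h, Matrix.one_apply_eq]
  · intro h
    rw [show τ * τ = 1 from Equiv.ext h, Matrix.permMatrix_one]

theorem one_apply_eq_one_iff {n : ℕ} (i j : Fin n) :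
    (1 : Matrix (Fin n) (Fin n) ℝ) i j = 1 ↔ i = j := by
  simp [Matrix.one_apply]

/-- A permutation matrix `Q` is strongly complementary to the identity if and
only if `Q² = 1` and every diagonal entry of `Q` vanishes. -/
theorem strongly_complementary_to_identity_iff {n : ℕ} (τ : Equiv.Perm (Fin n)) :
    StronglyComplementary (1 : Matrix (Fin n) (Fin n) ℝ) (τ.permMatrix ℝ) ↔
      (τ.permMatrix ℝ * τ.permMatrix ℝ = 1 ∧ ∀ i, τ.permMatrix ℝ i i = 0) := by
  simp only [StronglyComplementary, Complementary, one_apply_eq_one_iff,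
    permMatrix_apply_eq_one_iff, permMatrix_mul_self_eq_one_iff]
  constructor
  · rintro ⟨hc, hd⟩
    exact ⟨fun i => hc i i (τ i) (τ i) rfl rfl rfl, fun i => hd i i rfl⟩
  · rintro ⟨hs, hd⟩
    refine ⟨?_, ?_⟩
    · rintro i _ _ _ rfl rfl rfl
      exact hs i
    · rintro i _ rfl
      exact hd i
end

section
/- Let U be a unitary matrix of order n, let (e_j)_{j∈Z_n} denote the standard orthonormal basis of ℂⁿ indexed by the cyclic group Z_n, and for m, k ∈ Z_n define the vectors ψ_{m,k} = Σ_{j∈Z_n} U_{mj} · (e_j ⊗ e_{j+k}) in ℂⁿ ⊗ ℂⁿ. Then the n² vectors { ψ_{m,k} : m, k ∈ Z_n } form an orthonormal basis of ℂⁿ ⊗ ℂⁿ. -/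
open Matrix

/-- For a unitary matrix `U` of order `n`, the `n²` vectors
`ψ_{m,k} = Σ_j U_{mj} e_j ⊗ e_{j+k}` (indices in `ℤ/nℤ`) form an orthonormal
basis of `ℂⁿ ⊗ ℂⁿ`, identified with `ℂ^{n×n}` via `e_p ⊗ e_q ↦ e_{(p,q)}`. -/
theorem werner_basis_orthonormal {n : ℕ} [NeZero n]
    (U : Matrix (ZMod n) (ZMod n) ℂ) (hU : U ∈ Matrix.unitaryGroup (ZMod n) ℂ)
    (ψ : ZMod n × ZMod n → EuclideanSpace ℂ (ZMod n × ZMod n))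
    (hψ : ∀ m k p q : ZMod n,
      ψ (m, k) (p, q) = if q = p + k then U m p else 0) :
    Orthonormal ℂ ψ ∧ Submodule.span ℂ (Set.range ψ) = ⊤ := by
  have hortho : Orthonormal ℂ ψ := by
    rw [orthonormal_iff_ite]
    rintro ⟨m, k⟩ ⟨m', k'⟩
    have hrows : ∑ p, U m' p * star (U m p) = if m' = m then 1 else 0 := by
      simpa [Matrix.mul_apply, Matrix.one_apply] using
        congrFun (congrFun (Matrix.mem_unitaryGroup_iff.mp hU) m') m
    calc inner ℂ (ψ (m, k)) (ψ (m', k'))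
        = ∑ p, if k = k' then U m' p * star (U m p) else 0 := by
          simp only [PiLp.inner_apply, Fintype.sum_prod_type, hψ]
          refine Finset.sum_congr rfl fun p _ => ?_
          rw [Finset.sum_eq_single (p + k) (fun q _ hq => by simp [hq]) (by simp)]
          by_cases h : k = k' <;> simp [h]
      _ = if (m, k) = (m', k') then 1 else 0 := by
          by_cases h : k = k'
          · simp only [h, if_true, hrows, Prod.mk.injEq, and_true, eq_comm]
          · simp [h]
  exact ⟨hortho, hortho.linearIndependent.span_eq_top_of_card_eq_finrank' (by simp)⟩
end
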